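/- For every N ≥ 1, the number of N×N real matrices that are simultaneously orthogonal, circulant, and symmetric is exactly 2^n, where n = ⌊N/2⌋ + 1. More precisely, the map q ↦ F·diag(q)·F* is a bijection from the set of vectors q ∈ {±1}^N satisfying q_i = q_{−i} for all i ∈ ℤ/Nℤ (a set of cardinality 2^{⌊N/2⌋+1}) onto the set of orthogonal circulant symmetric matrices in M_N(ℝ). -/

import Mathlib

open Matrix

/-- The rescaled Fourier matrix `F = (w^{jk}/√N)_{j,k ∈ ℤ/Nℤ}`, `w = e^{2πi/N}`. -/
noncomputable def Four (N : ℕ) [NeZero N] : Matrix (ZMod N) (ZMod N) ℂ :=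
  Matrix.of fun j k =>
    Complex.exp (2 * (Real.pi : ℂ) * Complex.I * ((j.val * k.val : ℕ) : ℂ) / (N : ℂ)) /
      (Real.sqrt N : ℂ)

lemma Four_eq (N : ℕ) [NeZero N] (j k : ZMod N) :
    Four N j k = ZMod.stdAddChar (j * k) / (Real.sqrt N : ℂ) := by
  have h : (j * k : ZMod N) = (((j.val * k.val : ℕ) : ℤ) : ZMod N) := by
    push_cast
    simp [ZMod.natCast_zmod_val]
  rw [h, ZMod.stdAddChar_coe]
  simp [Four]

lemma star_char (N : ℕ) [NeZero N] (j : ZMod N) :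
    star (ZMod.stdAddChar j : ℂ) = ZMod.stdAddChar (-j) := by
  rw [ZMod.stdAddChar_apply, ZMod.stdAddChar_apply, AddChar.map_neg_eq_inv, Circle.coe_inv_eq_conj]
  rfl

lemma sqrt_sq_C (N : ℕ) : (Real.sqrt N : ℂ) * (Real.sqrt N : ℂ) = (N : ℂ) := by
  rw [← Complex.ofReal_mul, Real.mul_self_sqrt (Nat.cast_nonneg N)]
  simp

lemma entry (N : ℕ) [NeZero N] (q : ZMod N → ℂ) (i j : ZMod N) :
    (Four N * Matrix.diagonal q * (Four N)ᴴ) i j =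
      (∑ k, q k * ZMod.stdAddChar (k * (i - j))) / N := by
  rw [Matrix.mul_apply, Finset.sum_div]
  refine Finset.sum_congr rfl fun k _ => ?_
  rw [Matrix.mul_diagonal, Matrix.conjTranspose_apply, Four_eq, Four_eq, star_div₀, star_char]
  have h1 : star (Real.sqrt N : ℂ) = (Real.sqrt N : ℂ) := Complex.conj_ofReal _
  have h2 : k * (i - j) = i * k + -(j * k) := by ring
  rw [h1, h2, AddChar.map_add_eq_mul, ← sqrt_sq_C N]
  ring

lemma Four_unit (N : ℕ) [NeZero N] : Four N * (Four N)ᴴ = 1 := by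
  ext i j
  have h := entry N (fun _ => 1) i j
  have hd : (Matrix.diagonal (fun _ : ZMod N => (1 : ℂ))) = 1 := Matrix.diagonal_one
  rw [hd, Matrix.mul_one] at h
  rw [h]
  simp only [one_mul]
  rw [AddChar.sum_mulShift _ (ZMod.isPrimitive_stdAddChar N), Matrix.one_apply]
  have hN : (N : ℂ) ≠ 0 := Nat.cast_ne_zero.2 (NeZero.ne N)
  by_cases hij : i = j
  · simp [hij, ZMod.card, hN]
  · simp [hij, sub_eq_zero]

lemma Four_unit' (N : ℕ) [NeZero N] : (Four N)ᴴ * Four N = 1 :=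
  mul_eq_one_comm.1 (Four_unit N)

lemma fourConj_mul (N : ℕ) [NeZero N] (A B : Matrix (ZMod N) (ZMod N) ℂ) :
    (Four N * A * (Four N)ᴴ) * (Four N * B * (Four N)ᴴ) = Four N * (A * B) * (Four N)ᴴ := by
  calc _ = Four N * A * ((Four N)ᴴ * Four N) * B * (Four N)ᴴ := by simp only [Matrix.mul_assoc]
    _ = _ := by rw [Four_unit']; simp only [Matrix.mul_assoc, Matrix.one_mul]

lemma conj_inj (N : ℕ) [NeZero N] (A B : Matrix (ZMod N) (ZMod N) ℂ)
    (h : Four N * A * (Four N)ᴴ = Four N * B * (Four N)ᴴ) : A = B := by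
  have key : ∀ A : Matrix (ZMod N) (ZMod N) ℂ,
      (Four N)ᴴ * (Four N * A * (Four N)ᴴ) * Four N = A := by
    intro A
    calc _ = ((Four N)ᴴ * Four N) * A * ((Four N)ᴴ * Four N) := by simp only [Matrix.mul_assoc]
      _ = A := by rw [Four_unit']; simp
  rw [← key A, h, key B]

lemma ofReal_map_inj {n : Type*} {A B : Matrix n n ℝ}
    (h : A.map Complex.ofReal = B.map Complex.ofReal) : A = B :=
  Matrix.map_injective Complex.ofReal_injective h

lemma sum_symm (N : ℕ) [NeZero N] (q : ZMod N → ℂ) (hs : ∀ i, q i = q (-i)) (d : ZMod N) :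
    ∑ k, q k * ZMod.stdAddChar (k * (-d)) = ∑ k, q k * ZMod.stdAddChar (k * d) := by
  rw [← Equiv.sum_comp (Equiv.neg (ZMod N))]
  refine Finset.sum_congr rfl fun k _ => ?_
  simp only [Equiv.neg_apply, neg_mul_neg]
  rw [← hs]

lemma real_part (N : ℕ) [NeZero N] (q : ZMod N → ℂ) (hq : ∀ i, q i = 1 ∨ q i = -1)
    (hs : ∀ i, q i = q (-i)) :
    ((Four N * Matrix.diagonal q * (Four N)ᴴ).map Complex.re).map Complex.ofReal =
      Four N * Matrix.diagonal q * (Four N)ᴴ := by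
  ext i j
  simp only [Matrix.map_apply]
  apply Complex.conj_eq_iff_re.1
  rw [entry, map_div₀, map_sum, Complex.conj_natCast]
  congr 1
  rw [← sum_symm N q hs]
  refine Finset.sum_congr rfl fun k _ => ?_
  rw [map_mul, mul_neg, ← star_char]
  congr 1
  rcases hq k with h | h <;> simp [h]

lemma card_q (N : ℕ) [NeZero N] :
    ({q : ZMod N → ℂ | (∀ i, q i = 1 ∨ q i = -1) ∧ ∀ i, q i = q (-i)}).ncard =
      2 ^ (N / 2 + 1) := by
  classical
  let g : (Fin (N / 2 + 1) → Bool) → (ZMod N → ℂ) := fun f i =>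
    if f ⟨i.valMinAbs.natAbs, Nat.lt_succ_of_le (ZMod.natAbs_valMinAbs_le i)⟩ then 1 else -1
  have hk : ∀ k, k ≤ N / 2 → ((k : ZMod N).valMinAbs).natAbs = k := by
    intro k hk
    rw [ZMod.valMinAbs_natCast_of_le_half hk]
    simp
  have hg : Function.Injective g := by
    intro f f' h
    ext k
    have h1 := congrFun h ((k : ℕ) : ZMod N)
    simp only [g, hk k (Nat.le_of_lt_succ k.2)] at h1
    cases h2 : f k <;> cases h3 : f' k <;> simp [h2, h3] at h1 ⊢ <;> norm_num [Complex.ext_iff] at h1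
  have hr : {q : ZMod N → ℂ | (∀ i, q i = 1 ∨ q i = -1) ∧ ∀ i, q i = q (-i)} = Set.range g := by
    ext q
    constructor
    · rintro ⟨h1, h2⟩
      refine ⟨fun k => decide (q ((k : ℕ) : ZMod N) = 1), ?_⟩
      funext i
      have h3 : q ((i.valMinAbs.natAbs : ℕ) : ZMod N) = q i := by
        have h4 := (ZMod.natAbs_valMinAbs_eq_natAbs_valMinAbs
          (a := ((i.valMinAbs.natAbs : ℕ) : ZMod N)) (b := i)).1
          (hk _ (ZMod.natAbs_valMinAbs_le i))
        rcases h4 with h4 | h4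
        · rw [h4]
        · rw [h4, ← h2]
      simp only [g, h3, decide_eq_true_eq]
      rcases h1 i with h | h
      · simp [h]
      · rw [h]; norm_num
    · rintro ⟨f, rfl⟩
      refine ⟨fun i => ?_, fun i => ?_⟩
      · simp only [g]
        split_ifs <;> simp
      · simp only [g, ZMod.natAbs_valMinAbs_neg]
  rw [hr, Set.ncard_range_of_injective hg]
  simp

/-- There are exactly `2^(⌊N/2⌋+1)` orthogonal circulant symmetric
matrices in `M_N(ℝ)`; more precisely `q ↦ F·diag(q)·F*` is a bijection from the
set of sign vectors `q ∈ {±1}^N` with `q_i = q_{-i}` (which has cardinality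
`2^(⌊N/2⌋+1)`) onto the set of orthogonal circulant symmetric matrices. -/
theorem stmt6 (N : ℕ) [NeZero N] :
    ({U : Matrix (ZMod N) (ZMod N) ℝ |
        U * Uᵀ = 1 ∧ (∃ γ : ZMod N → ℝ, ∀ i j, U i j = γ (j - i)) ∧ Uᵀ = U}).ncard =
      2 ^ (N / 2 + 1) ∧
    ({q : ZMod N → ℂ | (∀ i, q i = 1 ∨ q i = -1) ∧ ∀ i, q i = q (-i)}).ncard =
      2 ^ (N / 2 + 1) ∧
    Set.BijOn (fun q : ZMod N → ℂ =>
        (Four N * Matrix.diagonal q * (Four N)ᴴ).map Complex.re)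
      {q : ZMod N → ℂ | (∀ i, q i = 1 ∨ q i = -1) ∧ ∀ i, q i = q (-i)}
      {U : Matrix (ZMod N) (ZMod N) ℝ |
        U * Uᵀ = 1 ∧ (∃ γ : ZMod N → ℝ, ∀ i j, U i j = γ (j - i)) ∧ Uᵀ = U} := by
  have hB : Set.BijOn (fun q : ZMod N → ℂ =>
        (Four N * Matrix.diagonal q * (Four N)ᴴ).map Complex.re)
      {q : ZMod N → ℂ | (∀ i, q i = 1 ∨ q i = -1) ∧ ∀ i, q i = q (-i)}
      {U : Matrix (ZMod N) (ZMod N) ℝ |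
        U * Uᵀ = 1 ∧ (∃ γ : ZMod N → ℝ, ∀ i j, U i j = γ (j - i)) ∧ Uᵀ = U} := by
    refine ⟨?_, ?_, ?_⟩
    · rintro q ⟨hq, hs⟩
      have hR := real_part N q hq hs
      have hT : ((Four N * Matrix.diagonal q * (Four N)ᴴ).map Complex.re)ᵀ =
          (Four N * Matrix.diagonal q * (Four N)ᴴ).map Complex.re := by
        ext i j
        simp only [Matrix.transpose_apply, Matrix.map_apply]
        rw [entry, entry, ← sum_symm N q hs, neg_sub]
      refine ⟨?_, ⟨fun d => ((∑ k, q k * ZMod.stdAddChar (k * (-d))) / N : ℂ).re, ?_⟩, hT⟩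
      · simp only [hT]
        apply ofReal_map_inj
        have := Matrix.map_mul (M := (Four N * Matrix.diagonal q * (Four N)ᴴ).map Complex.re)
          (L := (Four N * Matrix.diagonal q * (Four N)ᴴ).map Complex.re) (f := Complex.ofRealHom)
        refine this.trans ?_
        change _ * _ = _
        have e : ((Four N * Matrix.diagonal q * (Four N)ᴴ).map Complex.re).map Complex.ofRealHom
          = Four N * Matrix.diagonal q * (Four N)ᴴ := hR
        rw [e, fourConj_mul, Matrix.diagonal_mul_diagonal]
        have h1 : (fun i => q i * q i) = fun _ => (1 : ℂ) := by
          funext i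
          rcases hq i with h | h <;> simp [h]
        rw [h1, Matrix.diagonal_one, Matrix.mul_one, Four_unit]
        exact (Matrix.map_one _ Complex.ofReal_zero Complex.ofReal_one).symm
      · intro i j
        simp only [Matrix.map_apply]
        rw [entry, neg_sub]
    · rintro q ⟨hq, hs⟩ q' ⟨hq', hs'⟩ h
      have h' : (Four N * Matrix.diagonal q * (Four N)ᴴ).map Complex.re =
        (Four N * Matrix.diagonal q' * (Four N)ᴴ).map Complex.re := h
      have h2 := conj_inj N _ _ ((real_part N q hq hs).symm.trans
        ((congrArg (fun M => M.map Complex.ofReal) h').trans (real_part N q' hq' hs')))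
      exact Matrix.diagonal_injective h2
    · rintro U ⟨hO, ⟨γ, hγ⟩, hT⟩
      have hsym : ∀ d, γ (-d) = γ d := by
        intro d
        have h1 := congrFun (congrFun hT 0) d
        rw [Matrix.transpose_apply, hγ, hγ] at h1
        simpa using h1
      let q : ZMod N → ℂ := fun k => ∑ d, (γ d : ℂ) * ZMod.stdAddChar (d * k)
      have hqs : ∀ i, q i = q (-i) := fun i =>
        (sum_symm N (fun d => (γ d : ℂ)) (fun d => by simp only [hsym]) i).symm
      have hVF : U.map Complex.ofReal * Four N = Four N * Matrix.diagonal q := by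
        ext i k
        rw [Matrix.mul_apply, Matrix.mul_diagonal, Four_eq, ← Equiv.sum_comp (Equiv.addRight i),
          Finset.mul_sum]
        refine Finset.sum_congr rfl fun d _ => ?_
        rw [Matrix.map_apply, hγ, Four_eq, Equiv.coe_addRight, add_sub_cancel_right, add_mul,
          AddChar.map_add_eq_mul]
        ring
      have hV : Four N * Matrix.diagonal q * (Four N)ᴴ = U.map Complex.ofReal := by
        rw [← hVF, Matrix.mul_assoc, Four_unit, Matrix.mul_one]
      have hVV : U.map Complex.ofReal * U.map Complex.ofReal = 1 := by
        rw [hT] at hO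
        have := Matrix.map_mul (L := U) (M := U) (f := Complex.ofRealHom)
        rw [hO] at this
        exact this.symm.trans (Matrix.map_one _ Complex.ofReal_zero Complex.ofReal_one)
      have hq1 : ∀ i, q i = 1 ∨ q i = -1 := by
        rw [← hV, fourConj_mul, Matrix.diagonal_mul_diagonal] at hVV
        have h1 : Four N * 1 * (Four N)ᴴ = 1 := by rw [Matrix.mul_one, Four_unit]
        have h2 := conj_inj N _ _ (hVV.trans h1.symm)
        intro i
        have h3 := congrFun (congrFun h2 i) i
        rw [Matrix.diagonal_apply_eq, Matrix.one_apply_eq] at h3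
        exact mul_self_eq_one_iff.1 h3
      refine ⟨q, ⟨hq1, hqs⟩, ?_⟩
      simp only [hV]
      ext i j
      simp
  exact ⟨by rw [← hB.image_eq, Set.ncard_image_of_injOn hB.injOn, card_q], card_q N, hB⟩
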